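/- arXiv:2506.18837 — 7 statements merged into one kernel-verified Lean document; each statement's English description precedes it below -/
import Mathlib

section
/- The multiplication on B = ℕ × ℕ × {0,1} given by (i₁,j₁,p₁)·(i₂,j₂,p₂) = (i₁−j₁+i₂, j₂, max(p₁ ∸ (i₂−j₁), p₂)) if j₁ < i₂, (i₁, j₂, max(p₁,p₂)) if j₁ = i₂, and (i₁, j₁−i₂+j₂, max(p₁, p₂ ∸ (j₁−i₂))) if j₁ > i₂ (∸ being truncated subtraction on ℕ) is associative, and (0,0,0) is a two-sided identity for it; thus B is a monoid. -/
/-- The underlying set of the semigroup `B_ω^{F²}`: `ℕ × ℕ × {0,1}`. -/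
abbrev B : Type := ℕ × ℕ × Fin 2

/-- Truncated subtraction of a natural number from an element of `{0,1}`. -/
def fsub (p : Fin 2) (n : ℕ) : Fin 2 :=
  ⟨p.val - n, lt_of_le_of_lt (Nat.sub_le _ _) p.isLt⟩

/-- The multiplication on `B = ℕ × ℕ × {0,1}` realizing the semigroup `B_ω^{F²}`.
In the first case `i₁ − j₁ + i₂` is computed as `i₁ + (i₂ − j₁)` (exact, since
`j₁ < i₂`), and in the third case `j₁ − i₂ + j₂` as `(j₁ − i₂) + j₂` (exact, since
`j₁ > i₂`). -/
def bmul (x y : B) : B :=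
  if x.2.1 < y.1 then
    (x.1 + (y.1 - x.2.1), y.2.1, max (fsub x.2.2 (y.1 - x.2.1)) y.2.2)
  else if x.2.1 = y.1 then
    (x.1, y.2.1, max x.2.2 y.2.2)
  else
    (x.1, x.2.1 - y.1 + y.2.1, max x.2.2 (fsub y.2.2 (x.2.1 - y.1)))

/-- A uniform description of `bmul` by truncated subtraction, without case distinction. -/
lemma bmul_eq (x y : B) : bmul x y =
    (x.1 + (y.1 - x.2.1), x.2.1 - y.1 + y.2.1,
      max (fsub x.2.2 (y.1 - x.2.1)) (fsub y.2.2 (x.2.1 - y.1))) := by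
  have fsub_zero (p : Fin 2) : fsub p 0 = p := rfl
  unfold bmul
  split_ifs with h₁ h₂
  · simp [Nat.sub_eq_zero_of_le h₁.le, fsub_zero]
  · simp [h₂, fsub_zero]
  · simp [Nat.sub_eq_zero_of_le (not_lt.mp h₁), fsub_zero]

lemma fsub_val (p : Fin 2) (n : ℕ) : (fsub p n).val = p.val - n := rfl

/-- The multiplication `bmul` on `B` is associative and `(0,0,0)` is a two-sided
identity for it; thus `B` is a monoid. -/
theorem bmul_assoc_and_identity :
    (∀ x y z : B, bmul (bmul x y) z = bmul x (bmul y z)) ∧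
    (∀ x : B, bmul ((0, 0, 0) : B) x = x ∧ bmul x ((0, 0, 0) : B) = x) := by
  constructor
  · rintro ⟨i₁, j₁, p₁⟩ ⟨i₂, j₂, p₂⟩ ⟨i₃, j₃, p₃⟩
    simp only [bmul_eq, Prod.mk.injEq, Fin.ext_iff, Fin.coe_max, fsub_val]
    refine ⟨?_, ?_, ?_⟩
    · omega
    · omega
    · simp only [← Nat.sub_max_sub_right, Nat.sub_sub, max_assoc]
      congr 2
      · omega
      all_goals
        congr 1
        omega
  · rintro ⟨i, j, p⟩
    simp only [bmul_eq, Prod.mk.injEq, Fin.ext_iff, Fin.coe_max, fsub_val, Fin.val_zero]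
    omega
end

section
/- The map ϖ : B → B defined by ϖ(i,j,0) = (i,j,1) and ϖ(i,j,1) = (i+1,j+1,0) is an injective endomorphism of the semigroup B, i.e., ϖ is injective and ϖ(x·y) = ϖ(x)·ϖ(y) for all x, y ∈ B. -/
/-- The map `ϖ : B → B`, `ϖ(i,j,0) = (i,j,1)`, `ϖ(i,j,1) = (i+1,j+1,0)`. -/
def varpi (x : B) : B :=
  if x.2.2 = 0 then (x.1, x.2.1, 1) else (x.1 + 1, x.2.1 + 1, 0)

theorem fsub_of_pos (p : Fin 2) {n : ℕ} (hn : 0 < n) : fsub p n = 0 := by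
  ext
  simp only [fsub, Fin.val_zero]
  omega

theorem varpi_injective : Function.Injective varpi := by
  rintro ⟨i, j, p⟩ ⟨k, l, q⟩ h
  fin_cases p <;> fin_cases q <;> simp_all [varpi]

theorem varpi_bmul (x y : B) : varpi (bmul x y) = bmul (varpi x) (varpi y) := by
  obtain ⟨i, j, p⟩ := x
  obtain ⟨k, l, q⟩ := y
  rcases lt_trichotomy j k with h | rfl | h
  · obtain ⟨d, rfl⟩ := Nat.exists_eq_add_of_lt h
    fin_cases p <;> fin_cases q <;>
      simp [varpi, bmul, fsub_of_pos, add_assoc] <;> grind [fsub_of_pos]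
  · fin_cases p <;> fin_cases q <;> simp [varpi, bmul, fsub_of_pos, add_comm]
  · obtain ⟨d, rfl⟩ := Nat.exists_eq_add_of_lt h
    fin_cases p <;> fin_cases q <;>
      simp [varpi, bmul, fsub_of_pos, add_assoc] <;> grind [fsub_of_pos]

/-- `ϖ` is an injective endomorphism of the semigroup `B`. -/
theorem varpi_injective_endomorphism :
    Function.Injective varpi ∧
    ∀ x y : B, varpi (bmul x y) = bmul (varpi x) (varpi y) :=
  ⟨varpi_injective, varpi_bmul⟩
end

section
/- For every natural number n ≥ 1, the n-fold iterate ϖ^n : B → B is an injective endomorphism of the semigroup B. -/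
/-- Truncated subtraction of a positive number annihilates `{0,1}`, so `bmul` keeps only the
`{0,1}`-coordinate of the dominating factor. -/
theorem bmul_mk (i₁ j₁ i₂ j₂ : ℕ) (p₁ p₂ : Fin 2) :
    bmul (i₁, j₁, p₁) (i₂, j₂, p₂) =
      if j₁ < i₂ then (i₁ + (i₂ - j₁), j₂, p₂)
      else if j₁ = i₂ then (i₁, j₂, max p₁ p₂)
      else (i₁, j₁ - i₂ + j₂, p₁) := by
  simp only [bmul]
  split_ifs with h₁ h₂
  · rw [fsub_of_pos p₁ (by omega), max_eq_right (Fin.zero_le p₂)]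
  · rfl
  · rw [fsub_of_pos p₂ (by omega), max_eq_left (Fin.zero_le p₁)]

/-- For every `n ≥ 1`, the `n`-fold iterate `ϖ^n` is an injective endomorphism of `B`. -/
theorem varpi_iterate_injective_endomorphism (n : ℕ) (hn : 1 ≤ n) :
    Function.Injective (varpi^[n]) ∧
    ∀ x y : B, varpi^[n] (bmul x y) = bmul (varpi^[n] x) (varpi^[n] y) := by
  exact ⟨varpi_injective.iterate n, Function.Semiconj₂.iterate varpi_bmul n⟩
end

section
/- For every endomorphism ε of the semigroup B there exist a unique monoid endomorphism ε₁ of B (i.e., a multiplicative map with ε₁(0,0,0) = (0,0,0)) and a unique n ∈ ℕ such that ε = ϖ^n ∘ ε₁ (first apply ε₁, then ϖ^n). -/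
/-- The first coordinate of `x` in the bicyclic monoid, into which `B` embeds by
`(i, j, p) ↦ (2i + p, 2j + p)`. -/
def row (x : B) : ℕ := 2 * x.1 + x.2.2.val

/-- The second coordinate of `x` in the bicyclic monoid, into which `B` embeds by
`(i, j, p) ↦ (2i + p, 2j + p)`. -/
def col (x : B) : ℕ := 2 * x.2.1 + x.2.2.val

theorem eq_of_row_eq_of_col_eq {x y : B} (hr : row x = row y) (hc : col x = col y) : x = y := by
  obtain ⟨i, j, p⟩ := x
  obtain ⟨k, l, q⟩ := y
  simp only [row, col] at hr hc
  simp only [Prod.mk.injEq, Fin.ext_iff]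
  omega

theorem row_mod_two (x : B) : row x % 2 = col x % 2 := by
  simp only [row, col]
  omega

theorem exists_row_eq_and_col_eq {m n : ℕ} (h : m % 2 = n % 2) :
    ∃ x : B, row x = m ∧ col x = n :=
  ⟨(m / 2, n / 2, ⟨m % 2, Nat.mod_lt _ two_pos⟩), by simp only [row]; omega,
    by simp only [col]; omega⟩

theorem row_bmul (x y : B) : row (bmul x y) = row x + (row y - col x) := by
  obtain ⟨i, j, p⟩ := x
  obtain ⟨k, l, q⟩ := y
  simp only [bmul, row, col]
  split_ifs <;> simp only [Fin.coe_max, fsub] <;> omega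

theorem col_bmul (x y : B) : col (bmul x y) = col y + (col x - row y) := by
  obtain ⟨i, j, p⟩ := x
  obtain ⟨k, l, q⟩ := y
  simp only [bmul, row, col]
  split_ifs <;> simp only [Fin.coe_max, fsub] <;> omega

theorem row_varpi (x : B) : row (varpi x) = row x + 1 := by
  obtain ⟨i, j, p⟩ := x
  fin_cases p <;> simp [row, varpi]; omega

theorem col_varpi (x : B) : col (varpi x) = col x + 1 := by
  obtain ⟨i, j, p⟩ := x
  fin_cases p <;> simp [col, varpi]; omega

theorem row_iterate_varpi (n : ℕ) (x : B) : row (varpi^[n] x) = row x + n := by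
  induction n with
  | zero => rfl
  | succ n ih => rw [Function.iterate_succ_apply', row_varpi, ih, add_assoc]

theorem col_iterate_varpi (n : ℕ) (x : B) : col (varpi^[n] x) = col x + n := by
  induction n with
  | zero => rfl
  | succ n ih => rw [Function.iterate_succ_apply', col_varpi, ih, add_assoc]

theorem iterate_varpi_injective (n : ℕ) : Function.Injective varpi^[n] := by
  intro x y h
  have hr := congrArg row h
  have hc := congrArg col h
  simp only [row_iterate_varpi, col_iterate_varpi] at hr hc
  exact eq_of_row_eq_of_col_eq (by omega) (by omega)

theorem iterate_varpi_bmul (n : ℕ) (x y : B) :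
    varpi^[n] (bmul x y) = bmul (varpi^[n] x) (varpi^[n] y) := by
  apply eq_of_row_eq_of_col_eq
  · simp only [row_bmul, row_iterate_varpi, col_iterate_varpi]
    omega
  · simp only [col_bmul, row_iterate_varpi, col_iterate_varpi]
    omega

theorem exists_iterate_varpi_eq {n : ℕ} {x : B} (hr : n ≤ row x) (hc : n ≤ col x) :
    ∃ y, varpi^[n] y = x := by
  have hx := row_mod_two x
  obtain ⟨y, hyr, hyc⟩ :=
    exists_row_eq_and_col_eq (m := row x - n) (n := col x - n) (by omega)
  refine ⟨y, eq_of_row_eq_of_col_eq ?_ ?_⟩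
  · rw [row_iterate_varpi]
    omega
  · rw [col_iterate_varpi]
    omega

theorem row_one : row (0, 0, 0) = 0 := rfl

theorem col_one : col (0, 0, 0) = 0 := rfl

theorem bmul_one (x : B) : bmul x (0, 0, 0) = x := by
  apply eq_of_row_eq_of_col_eq
  · simp [row_bmul, row_one]
  · simp [col_bmul, row_one, col_one]

theorem one_bmul (x : B) : bmul (0, 0, 0) x = x := by
  apply eq_of_row_eq_of_col_eq
  · simp [row_bmul, row_one, col_one]
  · simp [col_bmul, col_one]

/-- Every endomorphism `ε` of `B` has a unique representation `ε = ϖ^n ∘ ε₁`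
with `ε₁` a monoid endomorphism of `B` and `n ∈ ℕ`. -/
theorem endomorphism_unique_decomposition (ε : B → B)
    (hε : ∀ x y : B, ε (bmul x y) = bmul (ε x) (ε y)) :
    ∃! en : (B → B) × ℕ,
      (∀ x y : B, en.1 (bmul x y) = bmul (en.1 x) (en.1 y)) ∧
      en.1 ((0, 0, 0) : B) = ((0, 0, 0) : B) ∧
      ε = varpi^[en.2] ∘ en.1 := by
  set e : B := ε (0, 0, 0) with he
  have hleft (x : B) : bmul e (ε x) = ε x := by rw [he, ← hε, one_bmul]
  have hright (x : B) : bmul (ε x) e = ε x := by rw [he, ← hε, bmul_one]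
  have hec : row e = col e := by
    have hr := congrArg row (hleft (0, 0, 0))
    have hc := congrArg col (hleft (0, 0, 0))
    rw [row_bmul, ← he] at hr
    rw [col_bmul, ← he] at hc
    omega
  have hex (x : B) : ∃ y, varpi^[row e] y = ε x := by
    have hr := congrArg row (hleft x)
    have hc := congrArg col (hright x)
    rw [row_bmul] at hr
    rw [col_bmul] at hc
    exact exists_iterate_varpi_eq (by omega) (by omega)
  choose f hf using hex
  refine ⟨(f, row e), ⟨fun x y => ?_, ?_, funext fun x => (hf x).symm⟩, ?_⟩
  · apply iterate_varpi_injective (row e)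
    rw [iterate_varpi_bmul, hf, hf, hf, hε]
  · apply iterate_varpi_injective (row e)
    rw [hf, ← he]
    apply eq_of_row_eq_of_col_eq
    · simp [row_iterate_varpi, row_one]
    · simp [col_iterate_varpi, hec, col_one]
  · rintro ⟨g, n⟩ ⟨-, hg, hgε⟩
    dsimp only at hg hgε
    have hn : n = row e := by
      rw [he, hgε, Function.comp_apply, hg, row_iterate_varpi, row_one, zero_add]
    subst hn
    refine Prod.ext (funext fun x => iterate_varpi_injective (row e) ?_) rfl
    exact (congrFun hgε x).symm.trans (hf x).symm
end

section
/- For every injective endomorphism ε of the semigroup B, exactly one of the following holds: (i) there exist unique n ∈ ℕ, k ≥ 1 and p with 0 ≤ p ≤ k−1 such that ε = ϖ^n ∘ α_{k,p}; (ii) there exist unique n ∈ ℕ, k ≥ 2 and p with 1 ≤ p ≤ k−1 such that ε = ϖ^n ∘ β_{k,p}. -/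
/-- The injective monoid endomorphism `α_{k,p}` of `B`. -/
def alphaMap (k p : ℕ) : B → B := fun x =>
  if x.2.2 = 0 then (k * x.1, k * x.2.1, 0) else (p + k * x.1, p + k * x.2.1, 1)

/-- The injective monoid endomorphism `β_{k,p}` of `B`. -/
def betaMap (k p : ℕ) : B → B := fun x =>
  if x.2.2 = 0 then (k * x.1, k * x.2.1, 0) else (p + k * x.1, p + k * x.2.1, 0)

/-- The row index of `x` when `B` is viewed as the set of pairs `(a, b)` of the bicyclic monoid
with `a ≡ b` modulo `2`. -/
def rowIndex (x : B) : ℕ := 2 * x.1 + x.2.2.val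

/-- The column index of `x` when `B` is viewed as the set of pairs `(a, b)` of the bicyclic monoid
with `a ≡ b` modulo `2`. -/
def colIndex (x : B) : ℕ := 2 * x.2.1 + x.2.2.val

/-- The element of `B` with row index `a` and column index `b`, provided `a ≡ b` modulo `2`. -/
def ofIndices (a b : ℕ) : B := (a / 2, b / 2, ⟨a % 2, Nat.mod_lt _ two_pos⟩)

theorem rowIndex_ofIndices (a b : ℕ) : rowIndex (ofIndices a b) = a := by
  simp only [rowIndex, ofIndices]; omega

theorem colIndex_ofIndices {a b : ℕ} (h : a % 2 = b % 2) : colIndex (ofIndices a b) = b := by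
  simp only [colIndex, ofIndices]; omega

theorem rowIndex_mod_two (x : B) : rowIndex x % 2 = colIndex x % 2 := by
  simp only [rowIndex, colIndex]; omega

theorem eq_of_indices_eq {x y : B} (hr : rowIndex x = rowIndex y)
    (hc : colIndex x = colIndex y) : x = y := by
  obtain ⟨i, j, p⟩ := x
  obtain ⟨i', j', p'⟩ := y
  simp only [rowIndex, colIndex] at hr hc
  simp only [Prod.mk.injEq, Fin.ext_iff]
  omega

theorem ofIndices_indices (x : B) : ofIndices (rowIndex x) (colIndex x) = x :=
  eq_of_indices_eq (rowIndex_ofIndices _ _) (colIndex_ofIndices (rowIndex_mod_two x))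

theorem val_max_fin_two (p q : Fin 2) : (max p q).val = max p.val q.val := by
  revert p q; decide

theorem rowIndex_bmul (x y : B) :
    rowIndex (bmul x y) = rowIndex x + (rowIndex y - colIndex x) := by
  obtain ⟨i, j, p⟩ := x
  obtain ⟨i', j', p'⟩ := y
  simp only [rowIndex, colIndex, bmul]
  split_ifs <;> simp only [val_max_fin_two, fsub] <;> omega

theorem colIndex_bmul (x y : B) :
    colIndex (bmul x y) = colIndex y + (colIndex x - rowIndex y) := by
  obtain ⟨i, j, p⟩ := x
  obtain ⟨i', j', p'⟩ := y
  simp only [rowIndex, colIndex, bmul]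
  split_ifs <;> simp only [val_max_fin_two, fsub] <;> omega

theorem bmul_ofIndices {a b c d : ℕ} (h : a % 2 = b % 2) (h' : c % 2 = d % 2) :
    bmul (ofIndices a b) (ofIndices c d) = ofIndices (a + (c - b)) (d + (b - c)) := by
  apply eq_of_indices_eq
  · simp only [rowIndex_bmul, rowIndex_ofIndices, colIndex_ofIndices h]
  · rw [colIndex_bmul, rowIndex_ofIndices, colIndex_ofIndices h, colIndex_ofIndices h',
      colIndex_ofIndices (by omega)]

theorem indices_varpi (x : B) :
    rowIndex (varpi x) = rowIndex x + 1 ∧ colIndex (varpi x) = colIndex x + 1 := by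
  obtain ⟨i, j, p⟩ := x
  fin_cases p <;> simp [rowIndex, colIndex, varpi]; omega

theorem indices_varpi_iterate (n : ℕ) (x : B) :
    rowIndex (varpi^[n] x) = rowIndex x + n ∧ colIndex (varpi^[n] x) = colIndex x + n := by
  induction n with
  | zero => simp
  | succ n ih =>
    rw [Function.iterate_succ_apply', (indices_varpi _).1, (indices_varpi _).2, ih.1, ih.2]
    omega

/-- The action of a map `ε` on the chain of idempotents of `B`, in terms of row indices. -/
def idemIndex (ε : B → B) (a : ℕ) : ℕ := rowIndex (ε (ofIndices a a))

theorem colIndex_map_idem {ε : B → B} (hε : ∀ x y : B, ε (bmul x y) = bmul (ε x) (ε y))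
    (a : ℕ) : colIndex (ε (ofIndices a a)) = idemIndex ε a := by
  have h := hε (ofIndices a a) (ofIndices a a)
  rw [bmul_ofIndices rfl rfl, Nat.sub_self, Nat.add_zero] at h
  have hr := congrArg rowIndex h
  have hc := congrArg colIndex h
  rw [rowIndex_bmul] at hr
  rw [colIndex_bmul] at hc
  unfold idemIndex
  omega

theorem indices_map_ofIndices {ε : B → B}
    (hε : ∀ x y : B, ε (bmul x y) = bmul (ε x) (ε y)) {a b : ℕ} (h : a % 2 = b % 2) :
    rowIndex (ε (ofIndices a b)) = idemIndex ε a ∧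
      colIndex (ε (ofIndices a b)) = idemIndex ε b := by
  have hl := hε (ofIndices a a) (ofIndices a b)
  have hr := hε (ofIndices a b) (ofIndices b b)
  have hli := hε (ofIndices a b) (ofIndices b a)
  have hri := hε (ofIndices b a) (ofIndices a b)
  simp only [bmul_ofIndices, h, Nat.sub_self, Nat.add_zero] at hl hr hli hri
  have h₁ := congrArg rowIndex hl
  have h₂ := congrArg colIndex hr
  have h₃ := congrArg rowIndex hli
  have h₄ := congrArg colIndex hri
  rw [rowIndex_bmul, colIndex_map_idem hε] at h₁
  rw [colIndex_bmul, colIndex_map_idem hε] at h₂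
  rw [rowIndex_bmul] at h₃
  rw [colIndex_bmul, colIndex_map_idem hε] at h₄
  simp only [idemIndex] at *
  omega

theorem indices_map {ε : B → B} (hε : ∀ x y : B, ε (bmul x y) = bmul (ε x) (ε y)) (x : B) :
    rowIndex (ε x) = idemIndex ε (rowIndex x) ∧
      colIndex (ε x) = idemIndex ε (colIndex x) := by
  simpa only [ofIndices_indices] using indices_map_ofIndices hε (rowIndex_mod_two x)

theorem idemIndex_strictMono {ε : B → B} (hε : ∀ x y : B, ε (bmul x y) = bmul (ε x) (ε y))
    (hinj : Function.Injective ε) : StrictMono (idemIndex ε) := by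
  apply strictMono_nat_of_lt_succ
  intro a
  have h := congrArg rowIndex (hε (ofIndices a a) (ofIndices (a + 1) (a + 1)))
  rw [bmul_ofIndices rfl rfl, rowIndex_bmul, colIndex_map_idem hε,
    show a + (a + 1 - a) = a + 1 by omega, show a + 1 + (a - (a + 1)) = a + 1 by omega] at h
  have hne : idemIndex ε a ≠ idemIndex ε (a + 1) := fun he => by
    have he' := congrArg rowIndex (hinj (eq_of_indices_eq (x := ε (ofIndices a a))
      (y := ε (ofIndices (a + 1) (a + 1))) he
      (by rw [colIndex_map_idem hε, colIndex_map_idem hε, he])))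
    simp only [rowIndex_ofIndices] at he'
    omega
  simp only [idemIndex] at *
  omega

theorem idemIndex_add_two_mul {ε : B → B} (hε : ∀ x y : B, ε (bmul x y) = bmul (ε x) (ε y))
    (a n : ℕ) :
    idemIndex ε (a + 2 * n) = idemIndex ε a + n * (idemIndex ε (a + 2) - idemIndex ε a) := by
  induction n with
  | zero => simp
  | succ n ih =>
    have h := congrArg colIndex (hε (ofIndices a (a + 2)) (ofIndices a (a + 2 * n)))
    rw [bmul_ofIndices (by omega) (by omega), colIndex_bmul,
      (indices_map_ofIndices hε (by omega)).2, (indices_map_ofIndices hε (by omega)).2,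
      (indices_map_ofIndices hε (by omega)).2, (indices_map_ofIndices hε (by omega)).1, ih,
      show a + 2 * n + (a + 2 - a) = a + 2 * (n + 1) by omega] at h
    rw [h, Nat.succ_mul, Nat.add_assoc]

theorem idemIndex_mod_two {ε : B → B} (hε : ∀ x y : B, ε (bmul x y) = bmul (ε x) (ε y))
    {a b : ℕ} (h : a % 2 = b % 2) : idemIndex ε a % 2 = idemIndex ε b % 2 := by
  rw [← (indices_map_ofIndices hε h).1, ← (indices_map_ofIndices hε h).2, rowIndex_mod_two]

/-- Two interlacing arithmetic progressions have the same common difference. -/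
theorem common_difference_eq {a b c d : ℕ} (h : ∀ n : ℕ, a + n * c < b + n * d)
    (h' : ∀ n : ℕ, b + n * d < a + (n + 1) * c) : c = d := by
  rcases lt_trichotomy c d with hlt | heq | hlt
  · have := h' (a + c)
    nlinarith [Nat.mul_le_mul_left (a + c) (Nat.succ_le_of_lt hlt)]
  · exact heq
  · have := h b
    nlinarith [Nat.mul_le_mul_left b (Nat.succ_le_of_lt hlt)]

/-- The sequence of idempotent indices of an injective endomorphism is determined by its first
value `n`, by its second value `n + d`, and by the common difference `2 * k`. -/
theorem exists_idemIndex_eq {ε : B → B} (hε : ∀ x y : B, ε (bmul x y) = bmul (ε x) (ε y))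
    (hinj : Function.Injective ε) :
    ∃ n k d : ℕ, 1 ≤ d ∧ d < 2 * k ∧ (∀ i, idemIndex ε (2 * i) = n + 2 * (k * i)) ∧
      ∀ i, idemIndex ε (2 * i + 1) = n + d + 2 * (k * i) := by
  have hmono := idemIndex_strictMono hε hinj
  have heven := idemIndex_add_two_mul hε 0
  have hodd := idemIndex_add_two_mul hε 1
  simp only [Nat.zero_add] at heven
  have h01 := hmono (show 0 < 1 by omega)
  have h12 := hmono (show 1 < 2 by omega)
  have hdiff : idemIndex ε 2 - idemIndex ε 0 = idemIndex ε (1 + 2) - idemIndex ε 1 := by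
    refine common_difference_eq (a := idemIndex ε 0) (b := idemIndex ε 1) ?_ ?_
    · intro n
      rw [← heven, ← hodd]
      exact hmono (by omega)
    · intro n
      rw [← heven, ← hodd]
      exact hmono (by omega)
  have hpar := idemIndex_mod_two hε (show 0 % 2 = 2 % 2 by omega)
  obtain ⟨k, hk⟩ : ∃ k, idemIndex ε 2 - idemIndex ε 0 = 2 * k :=
    ⟨(idemIndex ε 2 - idemIndex ε 0) / 2, by omega⟩
  refine ⟨idemIndex ε 0, k, idemIndex ε 1 - idemIndex ε 0, by omega, by omega, ?_, ?_⟩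
  · intro i
    rw [heven, hk]
    ring
  · intro i
    rw [Nat.add_comm (2 * i) 1, hodd, ← hdiff, hk, Nat.add_sub_cancel' h01.le]
    ring

theorem eq_varpi_iterate_comp {ε g : B → B}
    (hε : ∀ x y : B, ε (bmul x y) = bmul (ε x) (ε y)) (n : ℕ)
    (hr : ∀ x, idemIndex ε (rowIndex x) = rowIndex (g x) + n)
    (hc : ∀ x, idemIndex ε (colIndex x) = colIndex (g x) + n) : ε = varpi^[n] ∘ g := by
  funext x
  apply eq_of_indices_eq
  · rw [(indices_map hε x).1, hr, Function.comp_apply, (indices_varpi_iterate n _).1]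
  · rw [(indices_map hε x).2, hc, Function.comp_apply, (indices_varpi_iterate n _).2]

theorem rowIndex_varpi_iterate_comp_alphaMap {ε : B → B} {n k p : ℕ}
    (h : ε = varpi^[n] ∘ alphaMap k p) :
    rowIndex (ε (0, 0, 0)) = n ∧ rowIndex (ε (0, 0, 1)) = 2 * p + 1 + n ∧
      rowIndex (ε (1, 0, 0)) = 2 * k + n := by
  subst h
  simp only [Function.comp_apply, (indices_varpi_iterate n _).1]
  simp [rowIndex, alphaMap]

theorem rowIndex_varpi_iterate_comp_betaMap {ε : B → B} {n k p : ℕ}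
    (h : ε = varpi^[n] ∘ betaMap k p) :
    rowIndex (ε (0, 0, 0)) = n ∧ rowIndex (ε (0, 0, 1)) = 2 * p + n ∧
      rowIndex (ε (1, 0, 0)) = 2 * k + n := by
  subst h
  simp only [Function.comp_apply, (indices_varpi_iterate n _).1]
  simp [rowIndex, betaMap]

/-- Every injective endomorphism of `B` is, in exactly one way, either
`ϖ^n ∘ α_{k,p}` (unique `n`, `k ≥ 1`, `0 ≤ p ≤ k-1`) or `ϖ^n ∘ β_{k,p}`
(unique `n`, `k ≥ 2`, `1 ≤ p ≤ k-1`). -/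
theorem injective_endomorphism_classification (ε : B → B)
    (hε : ∀ x y : B, ε (bmul x y) = bmul (ε x) (ε y))
    (hinj : Function.Injective ε) :
    Xor'
      (∃! t : ℕ × ℕ × ℕ, 1 ≤ t.2.1 ∧ t.2.2 ≤ t.2.1 - 1 ∧
        ε = varpi^[t.1] ∘ alphaMap t.2.1 t.2.2)
      (∃! t : ℕ × ℕ × ℕ, 2 ≤ t.2.1 ∧ 1 ≤ t.2.2 ∧ t.2.2 ≤ t.2.1 - 1 ∧
        ε = varpi^[t.1] ∘ betaMap t.2.1 t.2.2) := by
  obtain ⟨n, k, d, hd, hdk, heven, hodd⟩ := exists_idemIndex_eq hε hinj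
  obtain ⟨p, rfl | rfl⟩ := Nat.even_or_odd' d
  · have hβ : ε = varpi^[n] ∘ betaMap k p := by
      refine eq_varpi_iterate_comp hε n ?_ ?_ <;> rintro ⟨i, j, q⟩ <;> fin_cases q <;>
        simp [rowIndex, colIndex, betaMap, heven, hodd] <;> ring
    have h := rowIndex_varpi_iterate_comp_betaMap hβ
    refine Or.inr ⟨⟨(n, k, p), ⟨by grind, by grind, by grind, hβ⟩, ?_⟩, ?_⟩
    · rintro ⟨n', k', p'⟩ ⟨-, -, -, h'⟩
      have := rowIndex_varpi_iterate_comp_betaMap h'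
      dsimp only at this
      simp only [Prod.mk.injEq]
      omega
    · rintro ⟨t, ⟨-, -, h'⟩, -⟩
      have := rowIndex_varpi_iterate_comp_alphaMap h'
      omega
  · have hα : ε = varpi^[n] ∘ alphaMap k p := by
      refine eq_varpi_iterate_comp hε n ?_ ?_ <;> rintro ⟨i, j, q⟩ <;> fin_cases q <;>
        simp [rowIndex, colIndex, alphaMap, heven, hodd] <;> ring
    have h := rowIndex_varpi_iterate_comp_alphaMap hα
    refine Or.inl ⟨⟨(n, k, p), ⟨by grind, by grind, hα⟩, ?_⟩, ?_⟩
    · rintro ⟨n', k', p'⟩ ⟨-, -, h'⟩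
      have := rowIndex_varpi_iterate_comp_alphaMap h'
      dsimp only at this
      simp only [Prod.mk.injEq]
      omega
    · rintro ⟨t, ⟨-, -, -, h'⟩, -⟩
      have := rowIndex_varpi_iterate_comp_betaMap h'
      omega
end

section
/- The set A of all annihilating (constant) endomorphisms of B, equipped with composition, is a right-zero semigroup (for all χ, χ' ∈ A, applying χ and then χ' equals χ'), it is countably infinite, and it is the minimal two-sided ideal of the monoid of all endomorphisms of B under composition: A is a two-sided ideal, and A is contained in every two-sided ideal of this monoid. -/
/-- The set of all endomorphisms of the semigroup `B`. -/
def EndB : Set (B → B) := {ε | ∀ x y : B, ε (bmul x y) = bmul (ε x) (ε y)}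

/-- The set of all annihilating (constant) endomorphisms of `B`. -/
def AnnB : Set (B → B) := {ε | ε ∈ EndB ∧ ∃ c : B, ∀ x : B, ε x = c}

/-- The constant map onto an idempotent is an annihilating endomorphism. -/
theorem const_mem_AnnB {c : B} (hc : bmul c c = c) : (fun _ : B => c) ∈ AnnB :=
  ⟨fun _ _ => hc.symm, c, fun _ => rfl⟩

theorem eq_of_mem_AnnB {χ : B → B} (hχ : χ ∈ AnnB) (x y : B) : χ x = χ y := by
  obtain ⟨-, c, hc⟩ := hχ
  rw [hc x, hc y]

theorem comp_mem_EndB {ε δ : B → B} (hε : ε ∈ EndB) (hδ : δ ∈ EndB) :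
    (fun x : B => δ (ε x)) ∈ EndB := fun x y =>
  (congrArg δ (hε x y)).trans (hδ _ _)

theorem bmul_self_diagonal (i : ℕ) (p : Fin 2) : bmul (i, i, p) (i, i, p) = (i, i, p) := by
  simp [bmul]

theorem countable_AnnB : AnnB.Countable := by
  refine Set.MapsTo.countable_of_injOn (f := fun χ : B → B => χ (0, 0, 0))
    (Set.mapsTo_univ _ _) ?_ Set.countable_univ
  intro χ hχ χ' hχ' h
  funext x
  rw [eq_of_mem_AnnB hχ x (0, 0, 0), eq_of_mem_AnnB hχ' x (0, 0, 0)]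
  exact h

theorem infinite_AnnB : AnnB.Infinite := by
  refine Set.infinite_of_injective_forall_mem (f := fun (i : ℕ) (_ : B) => ((i, i, 0) : B)) ?_
    fun i => const_mem_AnnB (bmul_self_diagonal i 0)
  intro i j h
  exact congrArg Prod.fst (congrFun h (0, 0, 0))

/-- The annihilating endomorphisms of `B` form a countably infinite right-zero
semigroup under composition, which is the minimal two-sided ideal of the monoid
of all endomorphisms of `B`. -/
theorem annihilating_endomorphisms_minimal_ideal :
    (∀ χ ∈ AnnB, ∀ χ' ∈ AnnB, (fun x : B => χ' (χ x)) = χ') ∧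
    AnnB.Countable ∧ AnnB.Infinite ∧
    (∀ χ ∈ AnnB, ∀ ε ∈ EndB,
      (fun x : B => ε (χ x)) ∈ AnnB ∧ (fun x : B => χ (ε x)) ∈ AnnB) ∧
    (∀ I : Set (B → B), I ⊆ EndB → I.Nonempty →
      (∀ δ ∈ I, ∀ ε ∈ EndB,
        (fun x : B => ε (δ x)) ∈ I ∧ (fun x : B => δ (ε x)) ∈ I) →
      AnnB ⊆ I) := by
  refine ⟨fun χ _ χ' hχ' => funext fun x => eq_of_mem_AnnB hχ' _ _, countable_AnnB,
    infinite_AnnB, fun χ hχ ε hε => ?_, fun I _ ⟨δ, hδ⟩ hI χ hχ => ?_⟩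
  · exact ⟨⟨comp_mem_EndB hχ.1 hε, ε (χ (0, 0, 0)),
        fun x => congrArg ε (eq_of_mem_AnnB hχ _ _)⟩,
      ⟨comp_mem_EndB hε hχ.1, χ (0, 0, 0), fun x => eq_of_mem_AnnB hχ _ _⟩⟩
  · have h := (hI δ hδ χ hχ.1).1
    rwa [show (fun x : B => χ (δ x)) = χ from funext fun x => eq_of_mem_AnnB hχ _ _] at h
end

section
/- For every endomorphism ε of the semigroup B that is neither injective nor a constant map, exactly one of the following holds: (i) there exist unique n ∈ ℕ and k ≥ 1 such that ε = ϖ^n ∘ γ_k; (ii) there exist unique n ∈ ℕ and k ≥ 1 such that ε = ϖ^n ∘ δ_k. -/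
/-- The endomorphism `γ_k` of `B`. -/
def gammaMap (k : ℕ) : B → B := fun x => (k * x.1, k * x.2.1, 0)

/-- The endomorphism `δ_k` of `B`. -/
def deltaMap (k : ℕ) : B → B := fun x =>
  if x.2.2 = 0 then (k * x.1, k * x.2.1, 0) else (k * (x.1 + 1), k * (x.2.1 + 1), 0)

/-- The embedding `(i, j, p) ↦ (2i + p, 2j + p)` of `B` into the bicyclic monoid `ℕ × ℕ`. -/
def toBicyclic (x : B) : ℕ × ℕ := (2 * x.1 + x.2.2.val, 2 * x.2.1 + x.2.2.val)

theorem toBicyclic_injective : Function.Injective toBicyclic := by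
  rintro ⟨i, j, p⟩ ⟨i', j', p'⟩ h
  simp only [toBicyclic, Prod.mk.injEq] at h
  have hp := p.isLt
  have hp' := p'.isLt
  simp only [Prod.mk.injEq, Fin.ext_iff]
  omega

theorem toBicyclic_bmul (x y : B) :
    toBicyclic (bmul x y) =
      ((toBicyclic x).1 + ((toBicyclic y).1 - (toBicyclic x).2),
        (toBicyclic y).2 + ((toBicyclic x).2 - (toBicyclic y).1)) := by
  obtain ⟨i, j, p⟩ := x
  obtain ⟨i', j', p'⟩ := y
  have hp := p.isLt
  have hp' := p'.isLt
  have hmax (a b : Fin 2) : (max a b).val = max a.val b.val := by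
    rcases le_total a b with h | h
    · rw [max_eq_right h, max_eq_right (Fin.le_def.mp h)]
    · rw [max_eq_left h, max_eq_left (Fin.le_def.mp h)]
  simp only [toBicyclic, bmul]
  split_ifs <;> simp only [hmax, fsub, Prod.mk.injEq] <;> omega

theorem toBicyclic_varpi (x : B) :
    toBicyclic (varpi x) = ((toBicyclic x).1 + 1, (toBicyclic x).2 + 1) := by
  obtain ⟨i, j, p⟩ := x
  fin_cases p
  · simp [toBicyclic, varpi]
  · simp [toBicyclic, varpi]
    omega

theorem toBicyclic_varpi_iterate (n : ℕ) (x : B) :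
    toBicyclic (varpi^[n] x) = ((toBicyclic x).1 + n, (toBicyclic x).2 + n) := by
  induction n with
  | zero => rfl
  | succ n ih => rw [Function.iterate_succ_apply', toBicyclic_varpi, ih]; rfl

theorem toBicyclic_varpi_gammaMap (n k i j : ℕ) (p : Fin 2) :
    toBicyclic ((varpi^[n] ∘ gammaMap k) (i, j, p)) =
      (2 * (k * i) + n, 2 * (k * j) + n) := by
  rw [Function.comp_apply, toBicyclic_varpi_iterate]
  simp [gammaMap, toBicyclic]

theorem toBicyclic_varpi_deltaMap_zero (n k i j : ℕ) :
    toBicyclic ((varpi^[n] ∘ deltaMap k) (i, j, 0)) =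
      (2 * (k * i) + n, 2 * (k * j) + n) := by
  rw [Function.comp_apply, toBicyclic_varpi_iterate]
  simp [deltaMap, toBicyclic]

theorem toBicyclic_varpi_deltaMap_one (n k i j : ℕ) :
    toBicyclic ((varpi^[n] ∘ deltaMap k) (i, j, 1)) =
      (2 * (k * (i + 1)) + n, 2 * (k * (j + 1)) + n) := by
  rw [Function.comp_apply, toBicyclic_varpi_iterate]
  simp [deltaMap, toBicyclic]

/-- Every endomorphism of `B` acts, in bicyclic coordinates, affinely with ratio `2k` on each of
the two layers; the layers start at `n` and `m` with `n ≤ m ≤ n + 2k`. -/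
theorem exists_toBicyclic_endomorphism (ε : B → B)
    (hε : ∀ x y : B, ε (bmul x y) = bmul (ε x) (ε y)) :
    ∃ n m k : ℕ, n ≤ m ∧ m ≤ n + 2 * k ∧
      (∀ i j, toBicyclic (ε (i, j, 0)) = (2 * (k * i) + n, 2 * (k * j) + n)) ∧
      (∀ i j, toBicyclic (ε (i, j, 1)) = (2 * (k * i) + m, 2 * (k * j) + m)) := by
  have hmul {x y z : B} (h : bmul x y = z) :
      (toBicyclic (ε z)).1 =
          (toBicyclic (ε x)).1 + ((toBicyclic (ε y)).1 - (toBicyclic (ε x)).2) ∧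
        (toBicyclic (ε z)).2 =
          (toBicyclic (ε y)).2 + ((toBicyclic (ε x)).2 - (toBicyclic (ε y)).1) := by
    rw [← h, hε, toBicyclic_bmul]
    exact ⟨rfl, rfl⟩
  have hbmul {x y z : B} (h : toBicyclic z =
      ((toBicyclic x).1 + ((toBicyclic y).1 - (toBicyclic x).2),
        (toBicyclic y).2 + ((toBicyclic x).2 - (toBicyclic y).1))) : bmul x y = z :=
    toBicyclic_injective ((toBicyclic_bmul x y).trans h.symm)
  have hparity (x : B) : (toBicyclic x).1 % 2 = (toBicyclic x).2 % 2 := by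
    simp only [toBicyclic]; omega
  obtain ⟨n, he⟩ : ∃ n, (toBicyclic (ε (0, 0, 0))).1 = n ∧ (toBicyclic (ε (0, 0, 0))).2 = n := by
    have h := hmul (show bmul (0, 0, 0) (0, 0, 0) = (0, 0, 0) from rfl)
    exact ⟨_, rfl, by omega⟩
  have hp_le : n ≤ (toBicyclic (ε (0, 1, 0))).1 := by
    have h := (hmul (show bmul (0, 0, 0) (0, 1, 0) = (0, 1, 0) from rfl)).2
    omega
  have hp_le' : n ≤ (toBicyclic (ε (0, 1, 0))).2 := by
    have h := (hmul (show bmul (0, 1, 0) (0, 0, 0) = (0, 1, 0) from rfl)).1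
    omega
  have hq_le : n ≤ (toBicyclic (ε (1, 0, 0))).2 := by
    have h := (hmul (show bmul (1, 0, 0) (0, 0, 0) = (1, 0, 0) from rfl)).1
    omega
  have hpq := hmul (show bmul (0, 1, 0) (1, 0, 0) = (0, 0, 0) from rfl)
  have hp₁ : (toBicyclic (ε (0, 1, 0))).1 = n := by omega
  obtain ⟨k, hk⟩ : ∃ k, (toBicyclic (ε (0, 1, 0))).2 = n + 2 * k := by
    have h := hparity (ε (0, 1, 0))
    exact ⟨((toBicyclic (ε (0, 1, 0))).2 - n) / 2, by omega⟩
  have hq₁ : (toBicyclic (ε (1, 0, 0))).1 = n + 2 * k ∧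
      (toBicyclic (ε (1, 0, 0))).2 = n := by omega
  clear hp_le hp_le' hq_le hpq
  obtain ⟨m, hf⟩ : ∃ m, (toBicyclic (ε (0, 0, 1))).1 = m ∧ (toBicyclic (ε (0, 0, 1))).2 = m := by
    have h := hmul (show bmul (0, 0, 1) (0, 0, 1) = (0, 0, 1) from rfl)
    exact ⟨_, rfl, by omega⟩
  have hnm : n ≤ m := by
    have h := (hmul (show bmul (0, 0, 0) (0, 0, 1) = (0, 0, 1) from rfl)).2
    omega
  have hmk : m ≤ n + 2 * k := by
    have h := (hmul (show bmul (1, 0, 0) (0, 1, 0) = (1, 1, 0) from rfl)).1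
    have h' := (hmul (show bmul (0, 0, 1) (1, 1, 0) = (1, 1, 0) from rfl)).2
    omega
  have hq (i : ℕ) : (toBicyclic (ε (i, 0, 0))).1 = 2 * (k * i) + n ∧
      (toBicyclic (ε (i, 0, 0))).2 = n := by
    induction i with
    | zero => simpa using he
    | succ i ih =>
      have h := hmul (show bmul (1, 0, 0) (i, 0, 0) = (i + 1, 0, 0) from
        hbmul (by simp [toBicyclic]; omega))
      rw [Nat.mul_succ]
      omega
  have hp (j : ℕ) : (toBicyclic (ε (0, j, 0))).1 = n ∧
      (toBicyclic (ε (0, j, 0))).2 = 2 * (k * j) + n := by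
    induction j with
    | zero => simpa using he
    | succ j ih =>
      have h := hmul (show bmul (0, j, 0) (0, 1, 0) = (0, j + 1, 0) from
        hbmul (by simp [toBicyclic]; omega))
      rw [Nat.mul_succ]
      omega
  refine ⟨n, m, k, hnm, hmk, fun i j => ?_, fun i j => ?_⟩
  · have h := hmul (show bmul (i, 0, 0) (0, j, 0) = (i, j, 0) from
      hbmul (by simp [toBicyclic]))
    have hi := hq i
    have hj := hp j
    ext <;> dsimp only <;> omega
  · have h := hmul (show bmul (i, 0, 0) (0, 0, 1) = (i, 0, 1) from
      hbmul (by simp [toBicyclic]))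
    have h' := hmul (show bmul (i, 0, 1) (0, j, 0) = (i, j, 1) from
      hbmul (by simp [toBicyclic]))
    have hi := hq i
    have hj := hp j
    ext <;> dsimp only <;> omega

theorem two_mul_add_inj_of_lt {k c d i j : ℕ} (hc : c < 2 * k) (hd : d < 2 * k)
    (h : 2 * (k * i) + c = 2 * (k * j) + d) : i = j ∧ c = d := by
  have hij : i = j := by
    rcases lt_trichotomy i j with hlt | heq | hlt
    · have := Nat.mul_le_mul_left k hlt
      rw [Nat.mul_succ] at this
      omega
    · exact heq
    · have := Nat.mul_le_mul_left k hlt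
      rw [Nat.mul_succ] at this
      omega
  subst hij
  exact ⟨rfl, by omega⟩

theorem injective_of_toBicyclic {ε : B → B} {n m k : ℕ} (hnm : n < m) (hmk : m < n + 2 * k)
    (h₀ : ∀ i j, toBicyclic (ε (i, j, 0)) = (2 * (k * i) + n, 2 * (k * j) + n))
    (h₁ : ∀ i j, toBicyclic (ε (i, j, 1)) = (2 * (k * i) + m, 2 * (k * j) + m)) :
    Function.Injective ε := by
  obtain ⟨d, rfl⟩ := Nat.exists_eq_add_of_lt hnm
  have h (i j : ℕ) (p : Fin 2) : toBicyclic (ε (i, j, p)) =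
      (2 * (k * i) + p.val * (d + 1) + n, 2 * (k * j) + p.val * (d + 1) + n) := by
    fin_cases p
    · simp [h₀]
    · simp [h₁]; omega
  have hlt (p : Fin 2) : p.val * (d + 1) < 2 * k := by
    fin_cases p <;> simp <;> omega
  rintro ⟨i, j, p⟩ ⟨i', j', p'⟩ heq
  have heq' := congrArg toBicyclic heq
  rw [h, h, Prod.mk.injEq] at heq'
  obtain ⟨hi, hp⟩ := two_mul_add_inj_of_lt (hlt p) (hlt p') (Nat.add_right_cancel heq'.1)
  obtain ⟨hj, -⟩ := two_mul_add_inj_of_lt (hlt p) (hlt p') (Nat.add_right_cancel heq'.2)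
  rw [hi, hj, Fin.ext (Nat.eq_of_mul_eq_mul_right d.succ_pos hp)]

/-- Every endomorphism of `B` that is neither injective nor constant is, in exactly
one way, either `ϖ^n ∘ γ_k` or `ϖ^n ∘ δ_k` with unique `n ∈ ℕ` and `k ≥ 1`. -/
theorem noninjective_nonannihilating_classification (ε : B → B)
    (hε : ∀ x y : B, ε (bmul x y) = bmul (ε x) (ε y))
    (hninj : ¬ Function.Injective ε)
    (hnconst : ¬ ∃ c : B, ∀ x : B, ε x = c) :
    Xor'
      (∃! t : ℕ × ℕ, 1 ≤ t.2 ∧ ε = varpi^[t.1] ∘ gammaMap t.2)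
      (∃! t : ℕ × ℕ, 1 ≤ t.2 ∧ ε = varpi^[t.1] ∘ deltaMap t.2) := by
  obtain ⟨n, m, k, hnm, hmk, h₀, h₁⟩ := exists_toBicyclic_endomorphism ε hε
  have hk : 1 ≤ k := by
    by_contra hk
    obtain rfl : k = 0 := by omega
    obtain rfl : m = n := by omega
    refine hnconst ⟨ε (0, 0, 0), ?_⟩
    rintro ⟨i, j, p⟩
    apply toBicyclic_injective
    fin_cases p
    · simp [h₀]
    · simp [h₀, h₁]
  have hγ {a b : ℕ} (h : ε = varpi^[a] ∘ gammaMap b) : a = n ∧ b = k ∧ m = n := by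
    have e₀ := congrArg Prod.fst (h₀ 0 0)
    have e₁ := congrArg Prod.fst (h₀ 1 0)
    have e₂ := congrArg Prod.fst (h₁ 0 0)
    rw [h, toBicyclic_varpi_gammaMap] at e₀ e₁ e₂
    dsimp only at e₀ e₁ e₂
    omega
  have hδ {a b : ℕ} (h : ε = varpi^[a] ∘ deltaMap b) : a = n ∧ b = k ∧ m = n + 2 * k := by
    have e₀ := congrArg Prod.fst (h₀ 0 0)
    have e₁ := congrArg Prod.fst (h₀ 1 0)
    have e₂ := congrArg Prod.fst (h₁ 0 0)
    rw [h, toBicyclic_varpi_deltaMap_zero] at e₀ e₁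
    rw [h, toBicyclic_varpi_deltaMap_one] at e₂
    dsimp only at e₀ e₁ e₂
    omega
  have hm : m = n ∨ m = n + 2 * k := by
    by_contra! hm
    exact hninj (injective_of_toBicyclic (by omega) (by omega) h₀ h₁)
  rcases hm with rfl | rfl
  · refine Or.inl ⟨⟨(m, k), ⟨hk, ?_⟩, ?_⟩, ?_⟩
    · funext ⟨i, j, p⟩
      apply toBicyclic_injective
      rw [toBicyclic_varpi_gammaMap]
      fin_cases p
      · exact h₀ i j
      · exact h₁ i j
    · rintro ⟨a, b⟩ ⟨-, h⟩
      exact Prod.ext (hγ h).1 (hγ h).2.1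
    · rintro ⟨⟨a, b⟩, ⟨-, h⟩, -⟩
      have := (hδ h).2.2
      omega
  · refine Or.inr ⟨⟨(n, k), ⟨hk, ?_⟩, ?_⟩, ?_⟩
    · funext ⟨i, j, p⟩
      apply toBicyclic_injective
      fin_cases p
      · exact (h₀ i j).trans (toBicyclic_varpi_deltaMap_zero n k i j).symm
      · refine (h₁ i j).trans (Eq.trans ?_ (toBicyclic_varpi_deltaMap_one n k i j).symm)
        ext <;> dsimp only <;> ring
    · rintro ⟨a, b⟩ ⟨-, h⟩
      exact Prod.ext (hδ h).1 (hδ h).2.1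
    · rintro ⟨⟨a, b⟩, ⟨-, h⟩, -⟩
      have := (hγ h).2.2
      omega
end
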